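/- In (2,3)-Maharaja Nim, there do not exist six consecutive positive integers i, i+1, …, i+5 such that for each of them the unique P-position in that column is upper; that is, it is impossible that for all j with i ≤ j ≤ i+5 the unique y with (j, y) a P-position satisfies y > j. -/

import Mathlib

/-- One move of (2,3)-Maharaja Nim: from `p` to `q` by a Nim move (decrease one
coordinate), a diagonal move (decrease both by the same positive amount), or a
Knight-type move `(2,3)` or `(3,2)`. -/
def Mah23Move (p q : ℕ × ℕ) : Prop :=
  (∃ k, 0 < k ∧ q.1 + k = p.1 ∧ q.2 = p.2) ∨
  (∃ k, 0 < k ∧ q.1 = p.1 ∧ q.2 + k = p.2) ∨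
  (∃ k, 0 < k ∧ q.1 + k = p.1 ∧ q.2 + k = p.2) ∨
  (q.1 + 2 = p.1 ∧ q.2 + 3 = p.2) ∨
  (q.1 + 3 = p.1 ∧ q.2 + 2 = p.2)

theorem Mah23Move.lt {p q : ℕ × ℕ} (h : Mah23Move p q) : q.1 + q.2 < p.1 + p.2 := by
  rcases h with ⟨k, hk, h1, h2⟩ | ⟨k, hk, h1, h2⟩ | ⟨k, hk, h1, h2⟩ | ⟨h1, h2⟩ | ⟨h1, h2⟩ <;> omega

/-- The P-positions of (2,3)-Maharaja Nim: `p` is P iff every move from `p`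
leads to a non-P position. -/
def Mah23P (p : ℕ × ℕ) : Prop :=
  ∀ q, Mah23Move p q → ¬ Mah23P q
termination_by p.1 + p.2
decreasing_by exact Mah23Move.lt ‹_›

namespace Mah

theorem P_iff (p : ℕ × ℕ) : Mah23P p ↔ ∀ q, Mah23Move p q → ¬ Mah23P q := by
  rw [Mah23P]

theorem not_of_move {p q : ℕ × ℕ} (hp : Mah23P p) (h : Mah23Move p q) : ¬ Mah23P q :=
  (P_iff p).1 hp q h

theorem move_swap {p q : ℕ × ℕ} (h : Mah23Move p q) : Mah23Move p.swap q.swap := by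
  rcases h with ⟨k, hk, h1, h2⟩ | ⟨k, hk, h1, h2⟩ | ⟨k, hk, h1, h2⟩ | ⟨h1, h2⟩ | ⟨h1, h2⟩
  · exact Or.inr (Or.inl ⟨k, hk, h2, h1⟩)
  · exact Or.inl ⟨k, hk, h2, h1⟩
  · exact Or.inr (Or.inr (Or.inl ⟨k, hk, h2, h1⟩))
  · exact Or.inr (Or.inr (Or.inr (Or.inr ⟨h2, h1⟩)))
  · exact Or.inr (Or.inr (Or.inr (Or.inl ⟨h2, h1⟩)))

theorem P_swap_aux (n : ℕ) : ∀ p : ℕ × ℕ, p.1 + p.2 = n → Mah23P p → Mah23P p.swap := by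
  induction n using Nat.strong_induction_on with
  | _ n ih =>
    intro p hn hp
    rw [P_iff]
    intro q hq hPq
    have h1 := move_swap hq
    rw [Prod.swap_swap] at h1
    have h2 := h1.lt
    have h3 := ih (q.1 + q.2) (by simp only [Prod.fst_swap, Prod.snd_swap] at h2; omega) q rfl hPq
    exact not_of_move hp h1 h3

theorem P_symm {x y : ℕ} (h : Mah23P (x, y)) : Mah23P (y, x) := P_swap_aux _ (x, y) rfl h

theorem row_inj {x x' y : ℕ} (h : Mah23P (x, y)) (h' : Mah23P (x', y)) : x = x' := by
  rcases lt_trichotomy x x' with hl | hl | hl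
  · exact absurd h (not_of_move h' (Or.inl ⟨x' - x, by omega, by simp; omega, rfl⟩))
  · exact hl
  · exact absurd h' (not_of_move h (Or.inl ⟨x - x', by omega, by simp; omega, rfl⟩))

theorem col_inj {x y y' : ℕ} (h : Mah23P (x, y)) (h' : Mah23P (x, y')) : y = y' :=
  row_inj (P_symm h) (P_symm h')

theorem diag_inj {x x' d : ℕ} (h : Mah23P (x, x + d)) (h' : Mah23P (x', x' + d)) : x = x' := by
  rcases lt_trichotomy x x' with hl | hl | hl
  · exact absurd h (not_of_move h'
      (Or.inr (Or.inr (Or.inl ⟨x' - x, by omega, by simp; omega, by simp; omega⟩))))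
  · exact hl
  · exact absurd h' (not_of_move h
      (Or.inr (Or.inr (Or.inl ⟨x - x', by omega, by simp; omega, by simp; omega⟩))))

theorem P00 : Mah23P (0, 0) := by
  rw [P_iff]
  intro q hq
  have := hq.lt
  simp at this

/-- the row (equivalently column) `r` is taken by an upper position -/
def Low (r : ℕ) : Prop := ∃ x, x < r ∧ Mah23P (x, r)

def dL (n : ℕ) : ℕ := [0,2,3,0,5,6,0,1,1,1,1].getD n 0
def dU (n : ℕ) : ℕ := [0,4,4,4,7,4,4,8,9,10,0].getD n 0

open Classical in
/-- automaton state before reading letter `n` (for `n ≥ 1`) -/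
noncomputable def q : ℕ → ℕ
  | 0 => 1
  | 1 => 1
  | n + 2 => if Low (n + 1) then dL (q (n + 1)) else dU (q (n + 1))

theorem q_low {n : ℕ} (hn : 1 ≤ n) (h : Low n) : q (n + 1) = dL (q n) := by
  obtain ⟨k, rfl⟩ : ∃ k, n = k + 1 := ⟨n - 1, by omega⟩
  rw [q, if_pos h]

theorem q_high {n : ℕ} (hn : 1 ≤ n) (h : ¬ Low n) : q (n + 1) = dU (q n) := by
  obtain ⟨k, rfl⟩ : ∃ k, n = k + 1 := ⟨n - 1, by omega⟩
  rw [q, if_neg h]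

theorem q_absorb {n : ℕ} (hn : 1 ≤ n) (h : q n = 0) (j : ℕ) : q (n + j) = 0 := by
  induction j with
  | zero => exact h
  | succ j ih =>
    by_cases hl : Low (n + j)
    · rw [← add_assoc, q_low (by omega) hl, ih]; rfl
    · rw [← add_assoc, q_high (by omega) hl, ih]; rfl

structure St where
  D : ℕ
  R : ℕ
  K0 : ℕ
  K1 : ℕ
  K2 : ℕ
  qi : ℕ
  qo : ℕ
deriving DecidableEq

/-- run the automaton on `n` bits of `R` -/
def runq (R q0 : ℕ) : ℕ → ℕ
  | 0 => q0
  | n + 1 => if R.testBit n then dL (runq R q0 n) else dU (runq R q0 n)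

def firstZero (B : ℕ) : ℕ → ℕ → ℕ
  | 0, e => e
  | f + 1, e => if B.testBit e then firstZero B f (e + 1) else e

def St.e (s : St) : ℕ := firstZero (s.D ||| s.R ||| s.K0) 8 0
def St.D2 (s : St) : ℕ := s.D ||| 2 ^ s.e
def St.R2 (s : St) : ℕ := s.R ||| 2 ^ s.e
def St.sh (s : St) : ℕ := firstZero s.D2 8 0

def St.low (s : St) : St :=
  ⟨s.D, s.R >>> 1, s.K1, s.K2, 0, dL s.qi, runq s.R s.qo 1⟩

def St.high (s : St) : St :=
  ⟨s.D2 >>> s.sh, s.R2 >>> (s.sh + 1), s.K1 >>> s.sh, (s.K2 ||| 2 ^ (s.e + 1)) >>> s.sh,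
    (2 ^ s.e) >>> (s.sh + 1), dU s.qi, runq s.R2 s.qo (s.sh + 1)⟩

def reach : List St := [
  ⟨0,0,0,1,0,1,4⟩, ⟨0,0,0,1,0,4,4⟩, ⟨0,0,1,0,0,2,7⟩, ⟨0,0,0,1,0,7,4⟩, ⟨0,0,1,0,0,5,7⟩,
  ⟨2,1,0,4,1,4,8⟩, ⟨0,0,0,0,0,3,8⟩, ⟨0,0,0,1,0,8,4⟩, ⟨0,0,1,0,0,1,7⟩, ⟨0,0,0,0,0,6,8⟩,
  ⟨6,2,4,9,2,7,1⟩, ⟨2,0,4,1,0,5,1⟩, ⟨0,0,0,1,0,9,4⟩, ⟨0,0,0,0,0,2,8⟩, ⟨0,0,1,0,0,8,7⟩,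
  ⟨6,1,9,2,0,1,4⟩, ⟨0,0,0,0,0,4,7⟩, ⟨2,0,1,0,0,6,4⟩, ⟨0,0,0,1,0,10,4⟩, ⟨0,0,0,0,0,3,9⟩,
  ⟨2,1,0,4,1,9,8⟩, ⟨0,0,0,0,0,1,8⟩, ⟨22,8,2,32,8,4,5⟩, ⟨6,0,2,0,0,2,5⟩, ⟨0,0,0,0,0,5,8⟩,
  ⟨6,2,0,8,2,4,7⟩, ⟨6,2,4,9,2,10,1⟩, ⟨2,0,4,1,0,1,1⟩, ⟨0,0,0,0,0,2,9⟩, ⟨2,0,4,1,0,7,1⟩,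
  ⟨22,4,32,8,0,5,4⟩, ⟨0,0,0,0,0,4,8⟩, ⟨6,0,0,0,0,3,4⟩, ⟨0,0,0,0,0,6,9⟩, ⟨0,0,1,0,0,7,7⟩,
  ⟨6,1,8,2,0,5,8⟩, ⟨2,0,1,0,0,2,4⟩, ⟨0,0,0,0,0,3,10⟩, ⟨0,0,0,0,0,8,7⟩, ⟨2,0,1,0,0,1,4⟩,
  ⟨2,0,1,0,0,4,4⟩, ⟨22,2,8,0,0,6,7⟩, ⟨0,0,0,0,0,5,9⟩, ⟨2,1,0,4,1,8,8⟩, ⟨22,8,2,32,8,4,1⟩,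
  ⟨6,0,2,0,0,6,1⟩, ⟨2,0,0,0,0,3,7⟩, ⟨2,0,0,0,0,2,7⟩, ⟨6,2,0,8,2,7,7⟩, ⟨2,0,0,0,0,5,7⟩,
  ⟨2,0,0,0,0,4,7⟩, ⟨0,0,0,0,0,6,10⟩, ⟨6,2,4,9,2,9,1⟩, ⟨2,0,0,0,0,3,8⟩, ⟨6,1,8,2,0,1,8⟩,
  ⟨2,0,0,0,0,6,8⟩, ⟨0,0,0,0,0,7,7⟩, ⟨2,0,0,0,0,5,8⟩, ⟨0,0,1,0,0,10,7⟩, ⟨6,0,2,0,0,2,1⟩,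
  ⟨2,0,0,0,0,6,9⟩]

def St.ok (s : St) : Prop :=
  s.qo ≠ 0 ∧ dU (dU (dU (dU (dU (dU s.qi))))) = 0 ∧
  (dL s.qi = 0 ∨ s.low ∈ reach) ∧
  (dU s.qi = 0 ∨ (s.high ∈ reach ∧
    (∀ k < s.e, (s.D ||| s.R ||| s.K0).testBit k = true) ∧
    (s.D ||| s.R ||| s.K0).testBit s.e = false ∧
    (∀ k < s.sh, s.D2.testBit k = true)))

instance (s : St) : Decidable s.ok := by unfold St.ok; infer_instance

theorem reach_ok : ∀ s ∈ reach, s.ok := by decide +kernel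

/-- knight attack on `(c + j, r)` from columns `< c` -/
def Kn (c j r : ℕ) : Prop :=
  ∃ x y, x < c ∧ Mah23P (x, y) ∧ ((x + 2 = c + j ∧ y + 3 = r) ∨ (x + 3 = c + j ∧ y + 2 = r))

structure Inv (c m : ℕ) (s : St) : Prop where
  hc : 1 ≤ c
  hm : 1 ≤ m
  hD0 : ∀ d < m, ∃ x < c, Mah23P (x, x + d)
  hD : ∀ e, (∃ x < c, Mah23P (x, x + (m + e))) ↔ s.D.testBit e = true
  hR : ∀ e, (∃ x < c, Mah23P (x, c + m + e)) ↔ s.R.testBit e = true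
  hK0 : ∀ e, Kn c 0 (c + 0 + m + e) ↔ s.K0.testBit e = true
  hK1 : ∀ e, Kn c 1 (c + 1 + m + e) ↔ s.K1.testBit e = true
  hK2 : ∀ e, Kn c 2 (c + 2 + m + e) ↔ s.K2.testBit e = true
  hqi : s.qi = q c
  hqo : s.qo = q (c + m)

theorem low_final {c m r : ℕ} (h0 : ∀ d < m, ∃ x < c, Mah23P (x, x + d)) (hr : c ≤ r)
    (hr' : r < c + m) : Low r ↔ ∃ x < c, Mah23P (x, r) := by
  constructor
  · rintro ⟨x, hx, hP⟩
    by_cases hxc : x < c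
    · exact ⟨x, hxc, hP⟩
    · obtain ⟨x', hx', hP'⟩ := h0 (r - x) (by omega)
      have : r = x + (r - x) := by omega
      rw [this] at hP
      have := diag_inj hP hP'
      omega
  · rintro ⟨x, hx, hP⟩
    exact ⟨x, by omega, hP⟩

theorem post {c m sh D2 R2 a0 a1 a2 : ℕ} {qi qo : ℕ} (hc : 1 ≤ c) (hm : 1 ≤ m)
    (hD0 : ∀ d < m, ∃ x < c, Mah23P (x, x + d))
    (hD : ∀ e, (∃ x < c + 1, Mah23P (x, x + (m + e))) ↔ D2.testBit e = true)
    (hR : ∀ e, (∃ x < c + 1, Mah23P (x, c + m + e)) ↔ R2.testBit e = true)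
    (hK0 : ∀ e, Kn (c + 1) 0 (c + 1 + 0 + m + e) ↔ a0.testBit e = true)
    (hK1 : ∀ e, Kn (c + 1) 1 (c + 1 + 1 + m + e) ↔ a1.testBit e = true)
    (hK2 : ∀ e, Kn (c + 1) 2 (c + 1 + 2 + m + e) ↔ a2.testBit e = true)
    (hqi : qi = q (c + 1)) (hqo : qo = q (c + m))
    (hsh : ∀ k < sh, D2.testBit k = true) :
    Inv (c + 1) (m + sh) ⟨D2 >>> sh, R2 >>> (sh + 1), a0 >>> sh, a1 >>> sh, a2 >>> sh, qi,
      runq R2 qo (sh + 1)⟩ := by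
  have h0 : ∀ d < m + sh, ∃ x < c + 1, Mah23P (x, x + d) := by
    intro d hd
    by_cases hdm : d < m
    · obtain ⟨x, hx, hP⟩ := hD0 d hdm
      exact ⟨x, by omega, hP⟩
    · have := (hD (d - m)).2 (hsh _ (by omega))
      rwa [show m + (d - m) = d by omega] at this
  refine ⟨by omega, by omega, h0, ?_, ?_, ?_, ?_, ?_, hqi, ?_⟩
  · intro e
    rw [Nat.testBit_shiftRight, ← hD, add_assoc]
  · intro e
    rw [Nat.testBit_shiftRight, ← hR,
      show c + 1 + (m + sh) + e = c + m + (sh + 1 + e) by omega]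
  · intro e
    rw [Nat.testBit_shiftRight, ← hK0,
      show c + 1 + 0 + (m + sh) + e = c + 1 + 0 + m + (sh + e) by omega]
  · intro e
    rw [Nat.testBit_shiftRight, ← hK1,
      show c + 1 + 1 + (m + sh) + e = c + 1 + 1 + m + (sh + e) by omega]
  · intro e
    rw [Nat.testBit_shiftRight, ← hK2,
      show c + 1 + 2 + (m + sh) + e = c + 1 + 2 + m + (sh + e) by omega]
  · have key : ∀ n ≤ sh + 1, runq R2 qo n = q (c + m + n) := by
      intro n
      induction n with
      | zero => intro _; exact hqo
      | succ n ih =>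
        intro hn
        have hl : Low (c + m + n) ↔ R2.testBit n = true := by
          rw [low_final h0 (by omega) (by omega), hR]
        rw [runq, ih (by omega), ← add_assoc]
        split_ifs with hb
        · rw [q_low (by omega) (hl.2 hb)]
        · rw [q_high (by omega) (fun h => hb (hl.1 h))]
    rw [show c + 1 + (m + sh) = c + m + (sh + 1) by omega]
    exact key _ le_rfl

theorem ex_succ {c : ℕ} {p : ℕ → Prop} : (∃ x < c + 1, p x) ↔ (∃ x < c, p x) ∨ p c := by
  constructor
  · rintro ⟨x, hx, h⟩
    rcases Nat.lt_succ_iff_lt_or_eq.1 hx with h1 | rfl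
    · exact Or.inl ⟨x, h1, h⟩
    · exact Or.inr h
  · rintro (⟨x, hx, h⟩ | h)
    · exact ⟨x, by omega, h⟩
    · exact ⟨c, by omega, h⟩

theorem Kn_succ {c j r : ℕ} : Kn (c + 1) j r ↔ Kn c (j + 1) r ∨
    (∃ y, Mah23P (c, y) ∧ ((j = 1 ∧ y + 3 = r) ∨ (j = 2 ∧ y + 2 = r))) := by
  constructor
  · rintro ⟨x, y, hx, hP, h⟩
    rcases Nat.lt_succ_iff_lt_or_eq.1 hx with h1 | rfl
    · exact Or.inl ⟨x, y, h1, hP, by omega⟩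
    · exact Or.inr ⟨y, hP, by omega⟩
  · rintro (⟨x, y, hx, hP, h⟩ | ⟨y, hP, h⟩)
    · exact ⟨x, y, by omega, hP, by omega⟩
    · exact ⟨c, y, by omega, hP, by omega⟩

theorem Kn3 {c r : ℕ} : ¬ Kn c 3 r := by
  rintro ⟨x, y, hx, hP, h⟩
  omega

theorem step_low {c m : ℕ} {s : St} (h : Inv c m s) (hl : Low c) : Inv (c + 1) m s.low := by
  have hno : ∀ y, c ≤ y → ¬ Mah23P (c, y) := by
    intro y hy hP
    obtain ⟨x, hx, hP'⟩ := hl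
    have := col_inj hP (P_symm hP')
    omega
  have hKno : ∀ j e, ¬ (∃ y, Mah23P (c, y) ∧
      ((j = 1 ∧ y + 3 = c + 1 + j + m + e) ∨ (j = 2 ∧ y + 2 = c + 1 + j + m + e))) := by
    rintro j e ⟨y, hP, hy⟩
    have := h.hm
    exact hno y (by omega) hP
  have := post (sh := 0) (D2 := s.D) (R2 := s.R) (a0 := s.K1) (a1 := s.K2) (a2 := 0)
    (qi := dL s.qi) (qo := s.qo) h.hc h.hm h.hD0 ?_ ?_ ?_ ?_ ?_ ?_ h.hqo ?_
  · exact this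
  · intro e
    rw [ex_succ, or_iff_left (hno _ (by omega)), h.hD]
  · intro e
    rw [ex_succ, or_iff_left (hno _ (by omega)), h.hR]
  · intro e
    rw [Kn_succ, or_iff_left (hKno 0 e), ← h.hK1]
  · intro e
    rw [Kn_succ, or_iff_left (hKno 1 e), ← h.hK2]
  · intro e
    rw [Kn_succ, or_iff_left (hKno 2 e)]
    simp [Kn3]
  · rw [q_low h.hc hl, h.hqi]
  · intro k hk
    omega

theorem block {c m e : ℕ} {s : St} (h : Inv c m s)
    (hb : (s.D ||| s.R ||| s.K0).testBit e = true) : ¬ Mah23P (c, c + m + e) := by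
  intro hP
  rw [Nat.testBit_or, Nat.testBit_or, Bool.or_eq_true, Bool.or_eq_true] at hb
  rcases hb with (hb | hb) | hb
  · obtain ⟨x, hx, hP'⟩ := (h.hD e).2 hb
    rw [add_assoc] at hP
    have := diag_inj hP hP'
    omega
  · obtain ⟨x, hx, hP'⟩ := (h.hR e).2 hb
    have := row_inj hP hP'
    omega
  · obtain ⟨x, y, hx, hP', h1⟩ := (h.hK0 e).2 hb
    refine not_of_move hP ?_ hP'
    rcases h1 with ⟨h1, h2⟩ | ⟨h1, h2⟩
    · exact Or.inr (Or.inr (Or.inr (Or.inl ⟨h1, h2⟩)))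
    · exact Or.inr (Or.inr (Or.inr (Or.inr ⟨h1, h2⟩)))

theorem exists_P {c m e : ℕ} {s : St} (h : Inv c m s) (hl : ¬ Low c)
    (h1 : ∀ k < e, (s.D ||| s.R ||| s.K0).testBit k = true)
    (h2 : (s.D ||| s.R ||| s.K0).testBit e = false) : Mah23P (c, c + m + e) := by
  rw [Nat.testBit_or, Nat.testBit_or, Bool.or_eq_false_iff, Bool.or_eq_false_iff] at h2
  obtain ⟨⟨hD, hR⟩, hK⟩ := h2
  rw [P_iff]
  rintro ⟨a, b⟩ hq hP
  rcases hq with ⟨k, hk, e1, e2⟩ | ⟨k, hk, e1, e2⟩ | ⟨k, hk, e1, e2⟩ | hq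
  · simp only at e1 e2
    subst e2
    have := (h.hR e).1 ⟨a, by omega, hP⟩
    simp [hR] at this
  · simp only at e1 e2
    subst e1
    by_cases hb : b < a
    · exact hl ⟨b, hb, P_symm hP⟩
    by_cases hb2 : b < a + m
    · obtain ⟨x, hx, hP'⟩ := h.hD0 (b - a) (by omega)
      rw [show b = a + (b - a) by omega] at hP
      have := diag_inj hP hP'
      omega
    · refine block h (h1 (b - a - m) (by omega)) ?_
      rwa [show a + m + (b - a - m) = b by omega]
  · simp only at e1 e2
    have := (h.hD e).1 ⟨a, by omega, by rwa [show a + (m + e) = b by omega]⟩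
    simp [hD] at this
  · simp only at hq
    have := (h.hK0 e).1 ⟨a, b, by omega, hP, by omega⟩
    simp [hK] at this

theorem tb (a e k : ℕ) : (a ||| 2 ^ e).testBit k = true ↔ a.testBit k = true ∨ e = k := by
  rw [Nat.testBit_or, Bool.or_eq_true, Nat.testBit_two_pow]
  simp

theorem step_high {c m : ℕ} {s : St} (h : Inv c m s) (hl : ¬ Low c)
    (h1 : ∀ k < s.e, (s.D ||| s.R ||| s.K0).testBit k = true)
    (h2 : (s.D ||| s.R ||| s.K0).testBit s.e = false)
    (h3 : ∀ k < s.sh, s.D2.testBit k = true) : Inv (c + 1) (m + s.sh) s.high := by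
  have hP := exists_P h hl h1 h2
  have hm := h.hm
  have hiff : ∀ y, Mah23P (c, y) ↔ y = c + m + s.e :=
    fun y => ⟨fun hy => col_inj hy hP, fun hy => hy ▸ hP⟩
  have := post (sh := s.sh) (D2 := s.D2) (R2 := s.R2) (a0 := s.K1)
    (a1 := s.K2 ||| 2 ^ (s.e + 1)) (a2 := (2 ^ s.e) >>> 1)
    (qi := dU s.qi) (qo := s.qo) h.hc h.hm h.hD0 ?_ ?_ ?_ ?_ ?_ ?_ h.hqo h3
  · rw [← Nat.shiftRight_add, add_comm 1] at this
    exact this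
  · intro e
    rw [ex_succ, h.hD, St.D2, tb, hiff]
    apply or_congr_right
    omega
  · intro e
    rw [ex_succ, h.hR, St.R2, tb, hiff]
    apply or_congr_right
    omega
  · intro e
    rw [Kn_succ, or_iff_left, ← h.hK1]
    · rintro ⟨y, _, hy⟩
      omega
  · intro e
    rw [Kn_succ, tb, ← h.hK2]
    apply or_congr Iff.rfl
    simp only [hiff]
    constructor
    · rintro ⟨y, hy⟩
      omega
    · intro hy
      exact ⟨c + m + s.e, rfl, Or.inl ⟨trivial, by omega⟩⟩
  · intro e
    rw [Kn_succ, or_iff_right Kn3, Nat.testBit_shiftRight, Nat.testBit_two_pow]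
    simp only [hiff, decide_eq_true_eq]
    constructor
    · rintro ⟨y, hy⟩
      omega
    · intro hy
      exact ⟨c + m + s.e, rfl, Or.inr ⟨trivial, by omega⟩⟩
  · rw [q_high h.hc hl, h.hqi]

theorem inv_start : Inv 1 1 ⟨0, 0, 0, 1, 0, 1, 4⟩ := by
  have h0 : ∀ y, Mah23P (0, y) ↔ y = 0 :=
    fun y => ⟨fun hy => col_inj hy P00, fun hy => hy ▸ P00⟩
  have hL : ¬ Low 1 := by
    rintro ⟨x, hx, hP⟩
    obtain rfl : x = 0 := by omega
    have := (h0 1).1 hP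
    omega
  refine ⟨le_rfl, le_rfl, ?_, ?_, ?_, ?_, ?_, ?_, rfl, ?_⟩
  · intro d hd
    obtain rfl : d = 0 := by omega
    exact ⟨0, by omega, P00⟩
  · intro e
    simp only [Nat.zero_testBit, Bool.false_eq_true, iff_false]
    rintro ⟨x, hx, hP⟩
    obtain rfl : x = 0 := by omega
    have := (h0 _).1 hP
    omega
  · intro e
    simp only [Nat.zero_testBit, Bool.false_eq_true, iff_false]
    rintro ⟨x, hx, hP⟩
    obtain rfl : x = 0 := by omega
    have := (h0 _).1 hP
    omega
  · intro e
    simp only [Nat.zero_testBit, Bool.false_eq_true, iff_false]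
    rintro ⟨x, y, hx, hP, h⟩
    omega
  · intro e
    have : (1 : ℕ).testBit e = true ↔ e = 0 := by
      rw [show (1 : ℕ) = 2 ^ 0 from rfl, Nat.testBit_two_pow]
      simp [eq_comm]
    rw [this]
    constructor
    · rintro ⟨x, y, hx, hP, h⟩
      obtain rfl : x = 0 := by omega
      have := (h0 _).1 hP
      omega
    · rintro rfl
      exact ⟨0, 0, by omega, P00, by omega⟩
  · intro e
    simp only [Nat.zero_testBit, Bool.false_eq_true, iff_false]
    rintro ⟨x, y, hx, hP, h⟩
    obtain rfl : x = 0 := by omega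
    have := (h0 _).1 hP
    omega
  · rw [q_high le_rfl hL]
    rfl

theorem inv_all (n : ℕ) : ∃ m, ∃ s ∈ reach, Inv (n + 1) m s := by
  induction n with
  | zero => exact ⟨1, _, by decide, inv_start⟩
  | succ n ih =>
    obtain ⟨m, s, hs, h⟩ := ih
    obtain ⟨ho, -, hlow, hhigh⟩ := reach_ok s hs
    have hne : q (n + 1 + 1) ≠ 0 := by
      intro h0
      have := q_absorb (by omega) h0 (m - 1)
      have hm := h.hm
      rw [show n + 1 + 1 + (m - 1) = n + 1 + m by omega, ← h.hqo] at this
      exact ho this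
    by_cases hl : Low (n + 1)
    · rw [q_low h.hc hl, ← h.hqi] at hne
      exact ⟨m, _, hlow.resolve_left hne, step_low h hl⟩
    · rw [q_high h.hc hl, ← h.hqi] at hne
      obtain ⟨a, b, c, d⟩ := hhigh.resolve_left hne
      exact ⟨_, _, a, step_high h hl b c d⟩

end Mah

theorem maharaja23_no_six_consecutive_upper :
    ¬ ∃ i : ℕ, 1 ≤ i ∧ ∀ j : ℕ, i ≤ j → j ≤ i + 5 →
      ∃ y : ℕ, j < y ∧ Mah23P (j, y) := by
  rintro ⟨i, hi, hj⟩
  have hU : ∀ j, i ≤ j → j ≤ i + 5 → ¬ Mah.Low j := by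
    rintro j h1 h2 ⟨x, hx, hP⟩
    obtain ⟨y, hy, hP'⟩ := hj j h1 h2
    have := Mah.col_inj hP' (Mah.P_symm hP)
    omega
  obtain ⟨n, rfl⟩ : ∃ n, i = n + 1 := ⟨i - 1, by omega⟩
  obtain ⟨m, s, hs, h⟩ := Mah.inv_all n
  obtain ⟨m', s', hs', h'⟩ := Mah.inv_all (n + 6)
  have h6 := (Mah.reach_ok s hs).2.1
  rw [h.hqi, ← Mah.q_high (by omega) (hU _ (by omega) (by omega)),
    ← Mah.q_high (by omega) (hU _ (by omega) (by omega)),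
    ← Mah.q_high (by omega) (hU _ (by omega) (by omega)),
    ← Mah.q_high (by omega) (hU _ (by omega) (by omega)),
    ← Mah.q_high (by omega) (hU _ (by omega) (by omega)),
    ← Mah.q_high (by omega) (hU _ (by omega) (by omega))] at h6
  have h7 := Mah.q_absorb (by omega) h6 m'
  refine (Mah.reach_ok s' hs').1 ?_
  rw [h'.hqo, ← h7]
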